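/- For every natural number n ≥ 2, the accurate domination number of the ladder graph L_n satisfies γ_a(L_n) = ⌈n/2⌉ + 2. -/

import Mathlib

/-- `D` is a dominating set of the simple graph `G`: every vertex not in `D`
is adjacent to at least one vertex in `D`. -/
def IsDomSet {V : Type*} (G : SimpleGraph V) (D : Finset V) : Prop :=
  ∀ v : V, v ∉ D → ∃ u ∈ D, G.Adj u v

/-- `D` is an accurate dominating set of `G`: a dominating set such that no subset of
`V \ D` of cardinality `|D|` is a dominating set of `G`. -/
def IsAccDomSet {V : Type*} (G : SimpleGraph V) (D : Finset V) : Prop :=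
  IsDomSet G D ∧
    ∀ E : Finset V, (∀ v ∈ E, v ∉ D) → E.card = D.card → ¬ IsDomSet G E

/-- The domination number of `G`: the minimum cardinality of a dominating set. -/
noncomputable def domNum {V : Type*} (G : SimpleGraph V) : ℕ :=
  sInf {k | ∃ D : Finset V, IsDomSet G D ∧ D.card = k}

/-- The accurate domination number of `G`: the minimum cardinality of an accurate
dominating set. -/
noncomputable def accDomNum {V : Type*} (G : SimpleGraph V) : ℕ :=
  sInf {k | ∃ D : Finset V, IsAccDomSet G D ∧ D.card = k}

/-- `d(G,i)`: the number of dominating sets of `G` of cardinality `i`. -/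
noncomputable def numDomSets {V : Type*} (G : SimpleGraph V) (i : ℕ) : ℕ :=
  Set.ncard {D : Finset V | IsDomSet G D ∧ D.card = i}

/-- `d_a(G,i)`: the number of accurate dominating sets of `G` of cardinality `i`. -/
noncomputable def numAccDomSets {V : Type*} (G : SimpleGraph V) (i : ℕ) : ℕ :=
  Set.ncard {D : Finset V | IsAccDomSet G D ∧ D.card = i}

theorem IsDomSet.mono {V : Type*} {G : SimpleGraph V} {D E : Finset V} (hD : IsDomSet G D)
    (h : D ⊆ E) : IsDomSet G E := fun v hv =>
  let ⟨u, hu, huv⟩ := hD v fun hvD => hv (h hvD)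
  ⟨u, h hu, huv⟩

/-- A dominating set containing a closed neighbourhood is accurate. -/
theorem IsDomSet.isAccDomSet_of_closedNbhd_subset {V : Type*} {G : SimpleGraph V} {D : Finset V}
    (hD : IsDomSet G D) {v : V} (hv : v ∈ D) (hN : ∀ u, G.Adj u v → u ∈ D) : IsAccDomSet G D := by
  refine ⟨hD, fun E hE _ hdom => ?_⟩
  obtain ⟨u, hu, huv⟩ := hdom v fun h => hE v h hv
  exact hE u hu (hN u huv)

/-- An accurate dominating set `D` with at most half of the vertices admits no disjoint
dominating set of size at most `|D|`. -/
theorem IsAccDomSet.lt_card_of_disjoint {V : Type*} [Fintype V] [DecidableEq V]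
    {G : SimpleGraph V} {D E : Finset V} (hD : IsAccDomSet G D)
    (hcard : 2 * D.card ≤ Fintype.card V) (hE : IsDomSet G E) (hdisj : ∀ v ∈ E, v ∉ D) :
    D.card < E.card := by
  by_contra! hle
  have hsub : E ⊆ Dᶜ := fun v hv => Finset.mem_compl.2 (hdisj v hv)
  obtain ⟨F, hEF, hFD, hF⟩ := Finset.exists_subsuperset_card_eq hsub hle
    (by rw [Finset.card_compl]; omega)
  exact hD.2 F (fun v hv => Finset.mem_compl.1 (hFD hv)) hF (hE.mono hEF)

open SimpleGraph in
/-- In a prism over a graph of maximum degree at most two, a dominating set containing no closed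
neighbourhood has a disjoint dominating set that is no larger. -/
theorem exists_disjoint_isDomSet_boxProd {W : Type*} [Fintype W] [DecidableEq W]
    {H : SimpleGraph W} (hdeg : ∀ i a b c, H.Adj i a → H.Adj i b → H.Adj i c →
      a = b ∨ b = c ∨ a = c)
    {D : Finset (W × Fin 2)} (hD : IsDomSet (H □ (⊤ : SimpleGraph (Fin 2))) D)
    (hN : ∀ i, (∀ s, (i, s) ∈ D) → ∀ s, ∃ j, H.Adj i j ∧ (j, s) ∉ D) :
    ∃ E : Finset (W × Fin 2), IsDomSet (H □ (⊤ : SimpleGraph (Fin 2))) E ∧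
      (∀ v ∈ E, v ∉ D) ∧ E.card ≤ D.card := by
  have key : ∀ i, ∃ F : Finset (W × Fin 2), (∀ v ∈ F, v ∉ D) ∧
      F.card ≤ (D.filter fun v => v.1 = i).card ∧
      (∀ s, (i, s + 1) ∈ D → (i, s) ∉ D → (i, s) ∈ F) ∧
      ((∀ s, (i, s) ∈ D) → (∀ s, ∃ j, H.Adj i j ∧ (j, s) ∈ F) ∧
        ∀ j, H.Adj i j → (∀ s, (j, s) ∉ D) → ∃ s, (j, s) ∈ F) := by
    intro i
    by_cases hfull : ∀ s, (i, s) ∈ D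
    · have hcard : 2 ≤ (D.filter fun v => v.1 = i).card := by
        have : ({(i, 0), (i, 1)} : Finset (W × Fin 2)) ⊆ D.filter fun v => v.1 = i := by
          intro v hv
          simp only [Finset.mem_insert, Finset.mem_singleton] at hv
          rcases hv with rfl | rfl <;> simp [hfull]
        simpa using Finset.card_le_card this
      obtain ⟨a, ha, haD⟩ := hN i hfull 0
      obtain ⟨b₀, hb₀, hb₀D⟩ := hN i hfull 1
      obtain ⟨b, hb, hbD, hcov⟩ : ∃ b, H.Adj i b ∧ (b, 1) ∉ D ∧
          ∀ j, H.Adj i j → (∀ s, (j, s) ∉ D) → j = a ∨ j = b := by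
        by_cases hex : ∃ j, H.Adj i j ∧ (∀ s, (j, s) ∉ D) ∧ j ≠ a
        · obtain ⟨j, hj, hjD, hja⟩ := hex
          refine ⟨j, hj, hjD 1, fun k hk _ => ?_⟩
          have := hdeg i k a j hk ha hj
          tauto
        · push Not at hex
          exact ⟨b₀, hb₀, hb₀D, fun j hj hjD => Or.inl (hex j hj hjD)⟩
      refine ⟨{(a, 0), (b, 1)}, ?_, Finset.card_le_two.trans hcard,
        fun s _ h => absurd (hfull s) h, fun _ => ⟨?_, ?_⟩⟩
      · intro v hv
        simp only [Finset.mem_insert, Finset.mem_singleton] at hv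
        rcases hv with rfl | rfl <;> assumption
      · intro s
        fin_cases s
        · exact ⟨a, ha, by simp⟩
        · exact ⟨b, hb, by simp⟩
      · intro j hj hjD
        rcases hcov j hj hjD with rfl | rfl
        · exact ⟨0, by simp⟩
        · exact ⟨1, by simp⟩
    · by_cases hex : ∃ s, (i, s + 1) ∈ D ∧ (i, s) ∉ D
      · obtain ⟨s, hs, hs'⟩ := hex
        refine ⟨{(i, s)}, by simpa using hs', ?_, fun t ht ht' => ?_, fun h => absurd h hfull⟩
        · rw [Finset.card_singleton, Nat.one_le_iff_ne_zero, Finset.card_ne_zero]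
          exact ⟨(i, s + 1), by simp [hs]⟩
        · have : t = s := by
            by_contra hne
            have : t = s + 1 := by omega
            exact ht' (this ▸ hs)
          simp [this]
      · push Not at hex
        exact ⟨∅, by simp, by simp, fun s h h' => absurd (hex s h) h', fun h => absurd h hfull⟩
  choose F hFD hFcard hFsingle hFfull using key
  refine ⟨Finset.univ.biUnion F, ?_, ?_, ?_⟩
  · rintro ⟨i, s⟩ hv
    simp only [Finset.mem_biUnion, Finset.mem_univ, true_and] at hv ⊢
    by_cases h1 : (i, s) ∈ D
    · by_cases h2 : (i, s + 1) ∈ D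
      · have hfull : ∀ t, (i, t) ∈ D := by
          intro t
          have : t = s ∨ t = s + 1 := by omega
          rcases this with rfl | rfl <;> assumption
        obtain ⟨j, hj, hjF⟩ := (hFfull i hfull).1 s
        exact ⟨(j, s), ⟨i, hjF⟩, by simp [boxProd_adj, hj.symm]⟩
      · refine ⟨(i, s + 1), ⟨i, hFsingle i (s + 1) ?_ h2⟩, ?_⟩
        · have : s + 1 + 1 = s := by omega
          rwa [this]
        · simp [boxProd_adj]
    · by_cases h2 : (i, s + 1) ∈ D
      · exact absurd ⟨i, hFsingle i s h2 h1⟩ hv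
      · have hempty : ∀ t, (i, t) ∉ D := by
          intro t
          have : t = s ∨ t = s + 1 := by omega
          rcases this with rfl | rfl <;> assumption
        obtain ⟨⟨j, t⟩, hu, huv⟩ := hD (i, s + 1) h2
        rw [boxProd_adj] at huv
        rcases huv with ⟨hji, ht⟩ | ⟨-, hji⟩
        · dsimp only at hji ht
          subst ht
          by_cases h3 : (j, s) ∈ D
          · have hfull : ∀ t, (j, t) ∈ D := by
              intro t
              have : t = s ∨ t = s + 1 := by omega
              rcases this with rfl | rfl <;> assumption
            obtain ⟨t, ht⟩ := (hFfull j hfull).2 i hji hempty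
            refine ⟨(i, t), ⟨j, ht⟩, ?_⟩
            have hts : t ≠ s := by
              rintro rfl
              exact hv ⟨j, ht⟩
            simp [boxProd_adj, hts]
          · exact ⟨(j, s), ⟨j, hFsingle j s hu h3⟩, by simp [boxProd_adj, hji]⟩
        · dsimp only at hji
          subst hji
          exact absurd hu (hempty t)
  · intro v hv
    obtain ⟨i, -, hi⟩ := Finset.mem_biUnion.1 hv
    exact hFD i v hi
  · calc (Finset.univ.biUnion F).card ≤ ∑ i, (F i).card := Finset.card_biUnion_le
      _ ≤ ∑ i, (D.filter fun v => v.1 = i).card := Finset.sum_le_sum fun i _ => hFcard i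
      _ = D.card := (Finset.card_eq_sum_card_fiberwise fun _ _ => by simp).symm

/-- Lower bound for the column counts `c` of a set dominating an initial part of a ladder, when
the last column considered is nonempty. -/
theorem add_two_le_two_mul_sum_range {c : ℕ → ℕ} {m : ℕ} (h0 : 2 ≤ 2 * c 0 + c 1)
    (h : ∀ i, i + 1 < m → 2 ≤ c i + 2 * c (i + 1) + c (i + 2)) (hm : 1 ≤ c m) :
    m + 2 ≤ 2 * ∑ i ∈ Finset.range (m + 1), c i := by
  have aux : ∀ k, k + 1 < m →
      2 * k + 5 + c (k + 1) ≤ 4 * ∑ i ∈ Finset.range (k + 2), c i + c (k + 2) := by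
    intro k
    induction k with
    | zero =>
      intro hk
      have := h 0 hk
      simp only [Finset.sum_range_succ, Finset.sum_range_zero] at this ⊢
      norm_num at this ⊢
      omega
    | succ k ih =>
      intro hk
      have h1 := ih (by omega)
      have h2 := h (k + 1) hk
      rw [Finset.sum_range_succ]
      simp only [add_assoc, Nat.reduceAdd] at h1 h2 ⊢
      omega
  match m with
  | 0 => simp; omega
  | 1 => simp [Finset.sum_range_succ]; omega
  | k + 2 =>
    have := aux k (by omega)
    rw [Finset.sum_range_succ]
    omega

/-- Lower bound for the column counts `c` of a set dominating a ladder with `n` columns, when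
column `i` is full and the columns next to it are nonempty. -/
theorem add_four_le_two_mul_sum_range {c : ℕ → ℕ} {n i : ℕ} (hn : 2 ≤ n)
    (h0 : 2 ≤ 2 * c 0 + c 1) (hlast : 2 ≤ 2 * c (n - 1) + c (n - 2))
    (h : ∀ j, j + 2 < n → 2 ≤ c j + 2 * c (j + 1) + c (j + 2)) (hi : i < n) (hci : 2 ≤ c i)
    (hl : i ≠ 0 → 1 ≤ c (i - 1)) (hr : i + 1 < n → 1 ≤ c (i + 1)) :
    n + 4 ≤ 2 * ∑ j ∈ Finset.range n, c j := by
  have hleft : i ≠ 0 → i + 1 ≤ 2 * ∑ j ∈ Finset.range i, c j := by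
    intro hi0
    obtain ⟨k, rfl⟩ := Nat.exists_eq_succ_of_ne_zero hi0
    exact add_two_le_two_mul_sum_range h0 (fun j hj => h j (by omega)) (hl hi0)
  have hright : ∀ m, m + i + 1 = n → m ≠ 0 →
      m + 1 ≤ 2 * ∑ j ∈ Finset.range m, c (n - 1 - j) := by
    intro m hm hm0
    obtain ⟨k, rfl⟩ := Nat.exists_eq_succ_of_ne_zero hm0
    refine add_two_le_two_mul_sum_range (c := fun j => c (n - 1 - j)) (m := k) ?_ ?_ ?_
    · simpa [Nat.sub_sub] using hlast
    · intro j hj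
      have := h (n - 1 - (j + 2)) (by omega)
      rw [show n - 1 - (j + 2) + 1 = n - 1 - (j + 1) by omega,
        show n - 1 - (j + 2) + 2 = n - 1 - j by omega] at this
      omega
    · have := hr (by omega)
      rwa [show i + 1 = n - 1 - k by omega] at this
  have hsplit : ∑ j ∈ Finset.range n, c j = ∑ j ∈ Finset.range i, c j + c i +
      ∑ j ∈ Finset.range (n - 1 - i), c (n - 1 - j) := by
    rw [← Finset.sum_range_succ, ← Finset.sum_range_add_sum_Ico c (show i + 1 ≤ n from hi)]
    congr 1
    rw [Finset.sum_Ico_eq_sum_range, ← Finset.sum_range_reflect]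
    rw [show n - (i + 1) = n - 1 - i by omega]
    refine Finset.sum_congr rfl fun j hj => ?_
    rw [Finset.mem_range] at hj
    congr 1
    omega
  have := hright (n - 1 - i) (by omega)
  omega

open SimpleGraph in
/-- A dominating set of the ladder containing a closed neighbourhood has size at least
`⌈n/2⌉ + 2`. -/
theorem add_four_le_two_mul_card_of_closedNbhd_subset {n : ℕ} (hn : 2 ≤ n)
    {D : Finset (Fin n × Fin 2)} (hD : IsDomSet (pathGraph n □ (⊤ : SimpleGraph (Fin 2))) D)
    {i : Fin n} {s : Fin 2} (hi : ∀ t, (i, t) ∈ D)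
    (hN : ∀ j, (pathGraph n).Adj i j → (j, s) ∈ D) : n + 4 ≤ 2 * D.card := by
  let e : ℕ → Fin 2 → ℕ := fun j t => (D.filter fun v => v.1.val = j ∧ v.2 = t).card
  have he : ∀ v ∈ D, 1 ≤ e v.1.val v.2 := fun v hv =>
    Finset.card_pos.2 ⟨v, by simp [hv]⟩
  have hdom : ∀ j < n, ∀ t, 1 ≤ e j t + e j (t + 1) + e (j + 1) t +
      (if j = 0 then 0 else e (j - 1) t) := by
    intro j hj t
    by_cases hv : ((⟨j, hj⟩, t) : Fin n × Fin 2) ∈ D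
    · have := he _ hv
      dsimp only at this
      omega
    · obtain ⟨⟨k, t'⟩, hu, huv⟩ := hD _ hv
      have := he _ hu
      simp only [boxProd_adj, pathGraph_adj, top_adj] at huv
      rcases huv with ⟨hk | hk, rfl⟩ | ⟨ht, rfl⟩
      · rw [if_neg (by omega), show j - 1 = k.val by omega]
        dsimp only at this
        omega
      · rw [← hk] at this
        dsimp only at this
        omega
      · have ht' : t' = t + 1 := by omega
        subst ht'
        dsimp only at this
        omega
  have hsum : D.card = ∑ j ∈ Finset.range n, (e j 0 + e j 1) := by
    rw [Finset.card_eq_sum_card_fiberwise (f := fun v => v.1.val) (t := Finset.range n)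
      (fun v _ => by simp)]
    refine Finset.sum_congr rfl fun j _ => ?_
    rw [← Finset.card_union_of_disjoint]
    · congr 1
      ext ⟨k, t⟩
      fin_cases t <;> simp
    · rw [Finset.disjoint_left]
      simp +contextual
  have hlastzero : ∀ t, e n t = 0 := by
    intro t
    rw [Finset.card_eq_zero, Finset.filter_eq_empty_iff]
    rintro v - ⟨hv, -⟩
    exact absurd v.1.isLt (by omega)
  have hnbr : ∀ j (hj : j < n), (pathGraph n).Adj i ⟨j, hj⟩ → 1 ≤ e j 0 + e j 1 := by
    intro j hj hij
    have := he _ (hN _ hij)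
    dsimp only at this
    have hs : s = 0 ∨ s = 1 := by omega
    rcases hs with rfl | rfl <;> omega
  rw [hsum]
  refine add_four_le_two_mul_sum_range (c := fun j => e j 0 + e j 1) hn ?_ ?_ ?_ i.isLt ?_ ?_ ?_
  · have h0 := hdom 0 (by omega) 0
    have h1 := hdom 0 (by omega) 1
    simp at h0 h1
    omega
  · have h0 := hdom (n - 1) (by omega) 0
    have h1 := hdom (n - 1) (by omega) 1
    rw [Nat.sub_add_cancel (by omega), hlastzero, if_neg (by omega), Nat.sub_sub] at h0 h1
    simp at h0 h1
    omega
  · intro j hj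
    have h0 := hdom (j + 1) (by omega) 0
    have h1 := hdom (j + 1) (by omega) 1
    simp [add_assoc] at h0 h1
    omega
  · have h0 := he _ (hi 0)
    have h1 := he _ (hi 1)
    dsimp only at h0 h1 ⊢
    omega
  · intro h
    exact hnbr _ (by omega) (by rw [pathGraph_adj]; dsimp only; omega)
  · intro h
    exact hnbr _ h (by rw [pathGraph_adj]; dsimp only; omega)

open SimpleGraph in
/-- The ladder has a dominating set of size at most `⌈n/2⌉ + 2` containing the closed
neighbourhood of a corner. -/
theorem exists_isDomSet_ladder_closedNbhd_subset {n : ℕ} (hn : 2 ≤ n) :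
    ∃ D : Finset (Fin n × Fin 2), IsDomSet (pathGraph n □ (⊤ : SimpleGraph (Fin 2))) D ∧
      D.card ≤ (n + 1) / 2 + 2 ∧ (∀ t, (⟨0, by omega⟩, t) ∈ D) ∧ (⟨1, by omega⟩, 0) ∈ D := by
  let g : ℕ → Fin n × Fin 2 := fun j =>
    (⟨min (2 * j + 1) (n - 1), by omega⟩, ⟨j % 2, by omega⟩)
  let D : Finset (Fin n × Fin 2) :=
    (Finset.range ((n + 1) / 2)).image g ∪ {(⟨0, by omega⟩, 0), (⟨0, by omega⟩, 1)}
  have hg : ∀ j, 2 * j < n → g j ∈ D := fun j hj => by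
    refine Finset.mem_union_left _ (Finset.mem_image_of_mem _ ?_)
    rw [Finset.mem_range]
    omega
  have hzero : ∀ t, ((⟨0, by omega⟩, t) : Fin n × Fin 2) ∈ D := fun t => by
    refine Finset.mem_union_right _ ?_
    fin_cases t <;> simp
  have hcol : ∀ {i : Fin n} {t : Fin 2} (j : ℕ), 2 * j < n → min (2 * j + 1) (n - 1) = i →
      (i, t) ∉ D → ∃ u ∈ D, (pathGraph n □ (⊤ : SimpleGraph (Fin 2))).Adj u (i, t) := by
    intro i t j hj hji ht
    refine ⟨g j, hg j hj, ?_⟩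
    have h1 : (g j).1 = i := Fin.ext hji
    rw [boxProd_adj, top_adj]
    refine Or.inr ⟨fun h2 => ht ?_, h1⟩
    have h3 : g j = (i, t) := Prod.ext h1 h2
    exact h3 ▸ hg j hj
  refine ⟨D, ?_, ?_, hzero, ?_⟩
  · rintro ⟨i, t⟩ hv
    have hi := i.isLt
    rcases Nat.even_or_odd' i.val with ⟨k, hk | hk⟩
    · obtain rfl | hk0 := Nat.eq_zero_or_pos k
      · have : i = ⟨0, by omega⟩ := Fin.ext (by simpa using hk)
        exact absurd (this ▸ hzero t) hv
      · by_cases hlast : i.val = n - 1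
        · exact hcol k (by omega) (by omega) hv
        · obtain hp | hp : t.val = k % 2 ∨ t.val = (k - 1) % 2 := by omega
          · refine ⟨g k, hg k (by omega), ?_⟩
            rw [boxProd_adj, pathGraph_adj]
            refine Or.inl ⟨Or.inr ?_, Fin.ext hp.symm⟩
            simp only [g]
            omega
          · refine ⟨g (k - 1), hg _ (by omega), ?_⟩
            rw [boxProd_adj, pathGraph_adj]
            refine Or.inl ⟨Or.inl ?_, Fin.ext hp.symm⟩
            simp only [g]
            omega
    · exact hcol k (by omega) (by omega) hv
  · calc D.card ≤ _ := Finset.card_union_le _ _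
      _ ≤ (n + 1) / 2 + 2 := by
        gcongr
        · exact Finset.card_image_le.trans (by simp)
        · exact Finset.card_le_two
  · have : g 0 = (⟨1, by omega⟩, 0) :=
      Prod.ext (Fin.ext (by simp only [g]; omega)) (Fin.ext (by simp [g]))
    exact this ▸ hg 0 (by omega)

open SimpleGraph in
/-- For every `n ≥ 2`, the accurate domination number of the ladder graph
`L_n = P_n □ K_2` equals `⌈n/2⌉ + 2`. -/
theorem accDomNum_ladder (n : ℕ) (hn : 2 ≤ n) :
    accDomNum (pathGraph n □ (⊤ : SimpleGraph (Fin 2))) = (n + 1) / 2 + 2 := by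
  have hV : Fintype.card (Fin n × Fin 2) = n * 2 := by simp
  have hmem : (n + 1) / 2 + 2 ∈ {k | ∃ D : Finset (Fin n × Fin 2),
      IsAccDomSet (pathGraph n □ (⊤ : SimpleGraph (Fin 2))) D ∧ D.card = k} := by
    obtain ⟨D₀, hdom, hcard, h0, h1⟩ := exists_isDomSet_ladder_closedNbhd_subset hn
    obtain ⟨D, hsub, -, hDcard⟩ := Finset.exists_subsuperset_card_eq (Finset.subset_univ D₀)
      hcard (by rw [Finset.card_univ, hV]; omega)
    refine ⟨D, (hdom.mono hsub).isAccDomSet_of_closedNbhd_subset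
      (v := (⟨0, by omega⟩, 0)) (hsub (h0 0)) ?_, hDcard⟩
    rintro ⟨j, t⟩ hadj
    simp only [boxProd_adj, pathGraph_adj] at hadj
    rcases hadj with ⟨hj, rfl⟩ | ⟨-, rfl⟩
    · have : j = ⟨1, by omega⟩ := Fin.ext (by dsimp only; omega)
      exact this ▸ hsub h1
    · exact hsub (h0 t)
  refine le_antisymm (Nat.sInf_le hmem) (le_csInf ⟨_, hmem⟩ ?_)
  rintro _ ⟨D, hD, rfl⟩
  by_contra! hlt
  obtain ⟨E, hE, hdisj, hle⟩ := exists_disjoint_isDomSet_boxProd (H := pathGraph n)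
    (fun i a b c ha hb hc => by
      simp only [pathGraph_adj, Fin.ext_iff] at *
      omega) hD.1 (fun i hi s => by
      by_contra! hall
      have := add_four_le_two_mul_card_of_closedNbhd_subset hn hD.1 hi hall
      omega)
  exact absurd (hD.lt_card_of_disjoint (by rw [hV]; omega) hE hdisj) (by omega)
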